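/- Let (R, m) be a commutative Noetherian local ring and I, J proper ideals with cd(J, R) = 1. If k ≥ 2 is an integer with Supp H^k_I(R) ⊄ V(J), then the R-module H^k_{I∩J}(R) is not (I ∩ J)-cofinite; in particular H^k_{I∩J}(R) ≠ 0. -/

import Mathlib

open CategoryTheory

noncomputable section

universe u

/-- `Tor_i^R(A, B)` as an object of `ModuleCat R`. -/
def TorMod (R : Type u) [CommRing R] (i : ℕ) (A B : ModuleCat.{u} R) : ModuleCat.{u} R :=
  ((Tor (ModuleCat.{u} R) i).obj A).obj B

/-- `Ext^i_R(A, B)` as an object of `ModuleCat R`. -/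
def ExtMod (R : Type u) [CommRing R] (i : ℕ) (A B : ModuleCat.{u} R) : ModuleCat.{u} R :=
  ((Ext R (ModuleCat.{u} R) i).obj (Opposite.op A)).obj B

/-- `H^i_I(M)`, the `i`-th local cohomology of `M` with support in `I`. -/
def LC (R : Type u) [CommRing R] (I : Ideal R) (i : ℕ) (M : ModuleCat.{u} R) : ModuleCat.{u} R :=
  (localCohomology I i).obj M

/-- `M` is `I`-cofinite: `Supp M ⊆ V(I)` and all `Ext^i_R(R/I, M)` are finitely generated. -/
def IsCofinite (R : Type u) [CommRing R] (I : Ideal R) (M : ModuleCat.{u} R) : Prop :=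
  Module.support R M ⊆ PrimeSpectrum.zeroLocus (I : Set R) ∧
    ∀ i : ℕ, Module.Finite R (ExtMod R i (ModuleCat.of R (R ⧸ I)) M)

/-- `Γ_I(M) = ⋃ₙ (0 :_M Iⁿ)`, the `I`-torsion submodule of `M`. -/
def torsionGamma (R : Type u) [CommRing R] (I : Ideal R) (M : Type u) [AddCommGroup M]
    [Module R M] : Submodule R M :=
  ⨆ n : ℕ, Submodule.torsionBySet R M ((I ^ n : Ideal R) : Set R)


section compar
open Limits

variable {R : Type u} [CommRing R]

/-- generic representatives of homology classes. -/
def RepK (K : CochainComplex (ModuleCat.{u} R) ℕ) (n : ℕ) {E : ModuleCat.{u} R}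
    (e : E ≅ K.homology n) (f : K.X n) (ζ : E) : Prop :=
  ∃ z : K.cycles n, ConcreteCategory.hom (K.iCycles n) z = f ∧
    ConcreteCategory.hom (K.homologyπ n ≫ e.inv) z = ζ

section
variable {K : CochainComplex (ModuleCat.{u} R) ℕ} {n : ℕ} {E : ModuleCat.{u} R}
    {e : E ≅ K.homology n}

lemma RepK.add {f f' : K.X n} {ζ ζ' : E} (h : RepK K n e f ζ) (h' : RepK K n e f' ζ') :
    RepK K n e (f + f') (ζ + ζ') := by
  obtain ⟨z, hz, hz'⟩ := h
  obtain ⟨w, hw, hw'⟩ := h'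
  exact ⟨z + w, by rw [map_add, hz, hw], by rw [map_add, hz', hw']⟩

lemma RepK.smul {f : K.X n} {ζ : E} (r : R) (h : RepK K n e f ζ) :
    RepK K n e (r • f) (r • ζ) := by
  obtain ⟨z, hz, hz'⟩ := h
  exact ⟨r • z, by rw [map_smul, hz], by rw [map_smul, hz']⟩

lemma RepK.cocycle {f : K.X n} {ζ : E} (h : RepK K n e f ζ) (m : ℕ) :
    ConcreteCategory.hom (K.d n m) f = 0 := by
  obtain ⟨z, hz, hz'⟩ := h
  rw [← hz, ← ConcreteCategory.comp_apply, HomologicalComplex.iCycles_d]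
  rfl

lemma RepK.exists_of (e : E ≅ K.homology n) (ζ : E) : ∃ f, RepK K n e f ζ := by
  obtain ⟨z, rfl⟩ := (ModuleCat.epi_iff_surjective (K.homologyπ n ≫ e.inv)).1 inferInstance ζ
  exact ⟨_, z, rfl, rfl⟩

lemma RepK.exists_class (e : E ≅ K.homology n) (f : K.X n)
    (hf : ConcreteCategory.hom (K.d n (n+1)) f = 0) : ∃ ζ, RepK K n e f ζ := by
  have := K.i_cyclesMk (i := n) f (n+1) (by simp) hf
  exact ⟨_, _, this, rfl⟩

lemma RepK.zero_iff {e : E ≅ K.homology (n+1)} {f : K.X (n+1)} {ζ : E}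
    (h : RepK K (n+1) e f ζ) :
    ζ = 0 ↔ ∃ g : K.X n, ConcreteCategory.hom (K.d n (n+1)) g = f := by
  obtain ⟨z, rfl, rfl⟩ := h
  have ex : (ShortComplex.mk (K.toCycles n (n+1)) (K.homologyπ (n+1)) (by simp)).Exact :=
    ShortComplex.exact_of_g_is_cokernel _ (K.homologyIsCokernel n (n+1) (by simp))
  rw [ShortComplex.moduleCat_exact_iff] at ex
  constructor
  · intro h
    have h0 : ConcreteCategory.hom (K.homologyπ (n+1)) z = 0 := by
      have := congrArg (ConcreteCategory.hom e.hom) h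
      rw [← ConcreteCategory.comp_apply, Category.assoc, Iso.inv_hom_id, map_zero,
        Category.comp_id] at this
      exact this
    obtain ⟨g, hg⟩ := ex z h0
    refine ⟨g, ?_⟩
    change ConcreteCategory.hom (K.toCycles n (n+1)) g = z at hg
    rw [← hg]
    exact (ConcreteCategory.congr_hom (K.toCycles_i n (n+1)) g).symm
  · rintro ⟨g, hg⟩
    have : z = ConcreteCategory.hom (K.toCycles n (n+1)) g := by
      apply (ModuleCat.mono_iff_injective (K.iCycles (n+1))).1 inferInstance
      exact hg.symm.trans (ConcreteCategory.congr_hom (K.toCycles_i n (n+1)) g).symm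
    rw [this, ← ConcreteCategory.comp_apply, ← Category.assoc, K.toCycles_comp_homologyπ,
      zero_comp]
    rfl

lemma RepK.nat {K' : CochainComplex (ModuleCat.{u} R) ℕ} {E' : ModuleCat.{u} R}
    {e' : E' ≅ K'.homology n} (φ : K ⟶ K') (ψ : E ⟶ E')
    (comm : ψ ≫ e'.hom = e.hom ≫ HomologicalComplex.homologyMap φ n)
    {f : K.X n} {ζ : E} (h : RepK K n e f ζ) :
    RepK K' n e' (ConcreteCategory.hom (φ.f n) f) (ConcreteCategory.hom ψ ζ) := by
  obtain ⟨z, rfl, rfl⟩ := h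
  refine ⟨ConcreteCategory.hom (HomologicalComplex.cyclesMap φ n) z, ?_, ?_⟩
  · exact ConcreteCategory.congr_hom (HomologicalComplex.cyclesMap_i φ n) z
  · rw [← ConcreteCategory.comp_apply, ← ConcreteCategory.comp_apply]
    have : HomologicalComplex.cyclesMap φ n ≫ K'.homologyπ n ≫ e'.inv =
        (K.homologyπ n ≫ e.inv) ≫ ψ := by
      rw [← cancel_mono e'.hom]
      simp [comm]
    rw [this]
end

def yonMap {X X' : ModuleCat.{u} R} (P : ProjectiveResolution X) (P' : ProjectiveResolution X')
    (φ : P'.complex ⟶ P.complex) (Y : ModuleCat.{u} R) :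
    P.complex.linearYonedaObj R Y ⟶ P'.complex.linearYonedaObj R Y :=
  (HomologicalComplex.unopFunctor _ _).map
    (((((linearYoneda R (ModuleCat.{u} R)).obj Y).rightOp.mapHomologicalComplex _).map φ).op)

/-- map on unops. -/
def unopMap' {K L : ChainComplex (ModuleCat.{u} R)ᵒᵖ ℕ} (φ : K ⟶ L) : L.unop ⟶ K.unop :=
  (HomologicalComplex.unopFunctor _ _).map φ.op

lemma homologyUnop_nat {K L : ChainComplex (ModuleCat.{u} R)ᵒᵖ ℕ} (φ : K ⟶ L) (n : ℕ) :
    (HomologicalComplex.homologyMap φ n).unop ≫ (K.homologyUnop n).inv =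
      (L.homologyUnop n).inv ≫ HomologicalComplex.homologyMap (unopMap' φ) n := by
  have := HomologicalComplex.homologyOp_hom_naturality (unopMap' φ) n
  rw [Iso.eq_inv_comp, ← Category.assoc, Iso.comp_inv_eq]
  exact congrArg Quiver.Hom.unop this

lemma isoExt_nat {X X' : ModuleCat.{u} R} (P : ProjectiveResolution X)
    (P' : ProjectiveResolution X') (g : X' ⟶ X)
    (φ : P'.complex ⟶ P.complex) (comm : φ.f 0 ≫ P.π.f 0 = P'.π.f 0 ≫ g)
    (Y : ModuleCat.{u} R) (n : ℕ) :
    ((Ext R (ModuleCat.{u} R) n).map g.op).app Y ≫ (P'.isoExt (R := R) n Y).hom =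
      (P.isoExt (R := R) n Y).hom ≫ HomologicalComplex.homologyMap (yonMap P P' φ Y) n := by
  have h := ProjectiveResolution.isoLeftDerivedObj_inv_naturality g P' P φ comm
    ((linearYoneda R (ModuleCat.{u} R)).obj Y).rightOp n
  have h2 := congrArg Quiver.Hom.unop h
  have h3 := homologyUnop_nat
    ((((linearYoneda R (ModuleCat.{u} R)).obj Y).rightOp.mapHomologicalComplex _).map φ) n
  rw [unop_comp, unop_comp] at h2
  exact (Category.assoc _ _ _).symm.trans
    ((congrArg (fun t => t ≫ (HomologicalComplex.homologyUnop _ n).inv) h2).trans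
    ((Category.assoc _ _ _).trans 
      ((congrArg (fun t => 
        (P.isoLeftDerivedObj ((linearYoneda R (ModuleCat.{u} R)).obj Y).rightOp n).inv.unop ≫ t) h3).trans
        (Category.assoc _ _ _).symm)))

/-- `f` represents `ζ`. -/
def RepE {X Y : ModuleCat.{u} R} (P : ProjectiveResolution X) (n : ℕ) (f : P.complex.X n ⟶ Y)
    (ζ : ExtMod R n X Y) : Prop :=
  RepK (P.complex.linearYonedaObj R Y) n (P.isoExt (R := R) n Y) f ζ

variable {X Y : ModuleCat.{u} R} {P : ProjectiveResolution X} {n : ℕ}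

lemma RepE.add {f f' : P.complex.X n ⟶ Y} {ζ ζ'} (h : RepE P n f ζ) (h' : RepE P n f' ζ') :
    RepE P n (f + f') (ζ + ζ') := RepK.add h h'

lemma RepE.smul {f : P.complex.X n ⟶ Y} {ζ} (r : R) (h : RepE P n f ζ) :
    RepE P n (r • f) (r • ζ) := RepK.smul r h

lemma RepE.cocycle {f : P.complex.X n ⟶ Y} {ζ} (h : RepE P n f ζ) (m : ℕ) :
    P.complex.d m n ≫ f = 0 := RepK.cocycle h m

lemma RepE.exists_of (P : ProjectiveResolution X) (ζ : ExtMod R n X Y) : ∃ f, RepE P n f ζ :=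
  RepK.exists_of (P.isoExt (R := R) n Y) ζ

lemma RepE.exists_class (f : P.complex.X n ⟶ Y) (hf : P.complex.d (n+1) n ≫ f = 0) :
    ∃ ζ, RepE P n f ζ :=
  RepK.exists_class (P.isoExt (R := R) n Y) f hf

lemma RepE.zero_iff {f : P.complex.X (n+1) ⟶ Y} {ζ} (h : RepE P (n+1) f ζ) :
    ζ = 0 ↔ ∃ g : P.complex.X n ⟶ Y, P.complex.d (n+1) n ≫ g = f :=
  RepK.zero_iff h

lemma RepE.nat {X' : ModuleCat.{u} R} (P' : ProjectiveResolution X') (g : X' ⟶ X)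
    (φ : P'.complex ⟶ P.complex) (comm : φ.f 0 ≫ P.π.f 0 = P'.π.f 0 ≫ g)
    {f : P.complex.X n ⟶ Y} {ζ} (h : RepE P n f ζ) :
    RepE P' n (φ.f n ≫ f)
      (ConcreteCategory.hom (((Ext R (ModuleCat.{u} R) n).map g.op).app Y) ζ) :=
  RepK.nat (yonMap P P' φ Y) _ (isoExt_nat P P' g φ comm Y n) h

lemma RepE.sub {f f' : P.complex.X n ⟶ Y} {ζ ζ'} (h : RepE P n f ζ) (h' : RepE P n f' ζ') :
    RepE P n (f - f') (ζ - ζ') := by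
  have := h.add (h'.smul (-1))
  simpa [sub_eq_add_neg] using this

/-- comparison of the two versions of Ext. -/
def gfun (X Y : ModuleCat.{u} R) (n : ℕ) (α : Abelian.Ext.{u} X Y n) : ExtMod R n X Y :=
  (RepE.exists_class (P := projectiveResolution X)
    ((projectiveResolution X).extMk_surjective α (n+1) rfl).choose
    ((projectiveResolution X).extMk_surjective α (n+1) rfl).choose_spec.choose).choose

lemma smul_extMk (P : ProjectiveResolution X) (f : P.complex.X n ⟶ Y) (m : ℕ) (hm : n + 1 = m)
    (hf : P.complex.d m n ≫ f = 0) (r : R) :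
    r • P.extMk f m hm hf = (P.extMk (r • f) m hm (by simp [hf]) : Abelian.Ext.{u} X Y n) := by
  rw [Abelian.Ext.smul_eq_comp_mk₀, ProjectiveResolution.extMk_comp_mk₀]
  simp

lemma gfun_spec (α : Abelian.Ext.{u} X Y (n+1)) (f : (projectiveResolution X).complex.X (n+1) ⟶ Y)
    (hf) (h : (projectiveResolution X).extMk f (n+2) rfl hf = α) :
    RepE (projectiveResolution X) (n+1) f (gfun X Y (n+1) α) := by
  have h1 := (RepE.exists_class (P := projectiveResolution X)
    ((projectiveResolution X).extMk_surjective α (n+2) rfl).choose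
    ((projectiveResolution X).extMk_surjective α (n+2) rfl).choose_spec.choose).choose_spec
  change RepE _ _ _ (gfun X Y (n+1) α) at h1
  have h2 := ((projectiveResolution X).extMk_surjective α (n+2) rfl).choose_spec.choose_spec
  obtain ⟨ζ, hζ⟩ := RepE.exists_class (P := projectiveResolution X) f hf
  have h3 := hζ.sub h1
  have h4 : ζ - gfun X Y (n+1) α = 0 := by
    rw [h3.zero_iff]
    have := (projectiveResolution X).sub_extMk _ _ (n+2) rfl hf
      ((projectiveResolution X).extMk_surjective α (n+2) rfl).choose_spec.choose
    rw [h, h2, sub_self] at this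
    exact ((projectiveResolution X).extMk_eq_zero_iff _ _ _ _ n rfl).1 this.symm
  rw [sub_eq_zero] at h4
  rwa [h4] at hζ

lemma RepE.unique {f : P.complex.X (n+1) ⟶ Y} {ζ ζ'} (h : RepE P (n+1) f ζ)
    (h' : RepE P (n+1) f ζ') : ζ = ζ' := by
  have := h.sub h'
  rw [← sub_eq_zero, this.zero_iff]
  exact ⟨0, by simp⟩

/-- comparison, linear. -/
def glin (X Y : ModuleCat.{u} R) (n : ℕ) : Abelian.Ext.{u} X Y (n+1) →ₗ[R] ExtMod R (n+1) X Y where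
  toFun := gfun X Y (n+1)
  map_add' α β := by
    obtain ⟨f, hf, rfl⟩ := (projectiveResolution X).extMk_surjective α (n+2) rfl
    obtain ⟨f', hf', rfl⟩ := (projectiveResolution X).extMk_surjective β (n+2) rfl
    exact (gfun_spec _ _ _ ((projectiveResolution X).add_extMk _ _ _ _ hf hf').symm).unique
      ((gfun_spec _ _ _ rfl).add (gfun_spec _ _ _ rfl))
  map_smul' r α := by
    obtain ⟨f, hf, rfl⟩ := (projectiveResolution X).extMk_surjective α (n+2) rfl
    exact (gfun_spec _ _ _ (smul_extMk _ _ _ _ hf r).symm).unique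
      ((gfun_spec _ _ _ rfl).smul r)

lemma glin_injective (X Y : ModuleCat.{u} R) (n : ℕ) (α) (h : glin X Y n α = 0) : α = 0 := by
  obtain ⟨f, hf, rfl⟩ := (projectiveResolution X).extMk_surjective α (n+2) rfl
  rw [(projectiveResolution X).extMk_eq_zero_iff _ _ _ _ n rfl]
  exact (gfun_spec _ f hf rfl).zero_iff.1 h

lemma glin_surjective (X Y : ModuleCat.{u} R) (n : ℕ) (ζ) : ∃ α, glin X Y n α = ζ := by
  obtain ⟨f, hf⟩ := RepE.exists_of (projectiveResolution X) ζ
  exact ⟨(projectiveResolution X).extMk f (n+2) rfl (hf.cocycle _),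
    (gfun_spec _ f (hf.cocycle _) rfl).unique hf⟩

lemma glin_nat {X X' : ModuleCat.{u} R} (g : X' ⟶ X) (Y : ModuleCat.{u} R) (n : ℕ)
    (α : Abelian.Ext.{u} X Y (n+1)) :
    glin X' Y n ((Abelian.Ext.mk₀ g).comp α (zero_add _)) =
    ConcreteCategory.hom (((Ext R (ModuleCat.{u} R) (n+1)).map g.op).app Y) (glin X Y n α) := by
  obtain ⟨f, hf, rfl⟩ := (projectiveResolution X).extMk_surjective α (n+2) rfl
  have comm := ProjectiveResolution.lift_commutes_zero g (projectiveResolution X')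
    (projectiveResolution X)
  have h1 := (gfun_spec _ f hf rfl).nat (projectiveResolution X') g _ comm
  refine (gfun_spec _ _ (h1.cocycle (n+2)) ?_).unique h1
  exact (ProjectiveResolution.mk₀_comp_extMk f (n+2) rfl hf
     (R' := projectiveResolution X') (g := g) ⟨_, comm⟩).symm

end compar
section lcint
open CategoryTheory CategoryTheory.Limits Opposite

variable {R : Type u} [CommRing R]

/-- quotient map -/
def qm {A B : Ideal R} (h : A ≤ B) : ModuleCat.of R (R ⧸ A) ⟶ ModuleCat.of R (R ⧸ B) :=
  ModuleCat.ofHom (Submodule.mapQ A B LinearMap.id h)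

lemma qm_comp {A B C : Ideal R} (h : A ≤ B) (h' : B ≤ C) : qm h ≫ qm h' = qm (h.trans h') := by
  ext
  rfl

lemma qm_refl {A : Ideal R} : qm (le_refl A) = 𝟙 _ := by
  ext
  rfl

/-- restriction -/
abbrev res {A B : Ideal R} (h : A ≤ B) {Y : ModuleCat.{u} R} {i : ℕ}
    (ξ : Abelian.Ext.{u} (ModuleCat.of R (R ⧸ B)) Y i) :
    Abelian.Ext.{u} (ModuleCat.of R (R ⧸ A)) Y i :=
  (Abelian.Ext.mk₀ (qm h)).comp ξ (zero_add i)

lemma res_res {A B C : Ideal R} (h : A ≤ B) (h' : B ≤ C) {Y : ModuleCat.{u} R} {i : ℕ}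
    (ξ : Abelian.Ext.{u} (ModuleCat.of R (R ⧸ C)) Y i) :
    res h (res h' ξ) = res (h.trans h') ξ := by
  simp only [res, Abelian.Ext.mk₀_comp_mk₀_assoc, qm_comp]

lemma res_zero {A B : Ideal R} (h : A ≤ B) {Y : ModuleCat.{u} R} {i : ℕ} :
    res h (0 : Abelian.Ext.{u} (ModuleCat.of R (R ⧸ B)) Y i) = 0 := by
  simp [res]

lemma res_add {A B : Ideal R} (h : A ≤ B) {Y : ModuleCat.{u} R} {i : ℕ}
    (ξ η : Abelian.Ext.{u} (ModuleCat.of R (R ⧸ B)) Y i) :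
    res h (ξ + η) = res h ξ + res h η := by
  simp [res]

lemma res_sub {A B : Ideal R} (h : A ≤ B) {Y : ModuleCat.{u} R} {i : ℕ}
    (ξ η : Abelian.Ext.{u} (ModuleCat.of R (R ⧸ B)) Y i) :
    res h (ξ - η) = res h ξ - res h η := by
  simp [res, sub_eq_add_neg]

lemma res_smul {A B : Ideal R} (h : A ≤ B) {Y : ModuleCat.{u} R} {i : ℕ} (r : R)
    (ξ : Abelian.Ext.{u} (ModuleCat.of R (R ⧸ B)) Y i) :
    res h (r • ξ) = r • res h ξ := by
  simp [res]

lemma res_comp {A B : Ideal R} (h : A ≤ B) {Y Z : ModuleCat.{u} R} {i j l : ℕ} (hl : i + j = l)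
    (ξ : Abelian.Ext.{u} (ModuleCat.of R (R ⧸ B)) Y i) (η : Abelian.Ext.{u} Y Z j) :
    res h (ξ.comp η hl) = (res h ξ).comp η hl := by
  simp only [res]
  rw [Abelian.Ext.comp_assoc _ _ _ (zero_add i) hl (by lia)]

/-- cocone components -/
def lcι (a : Ideal R) (i n : ℕ) (Y : ModuleCat.{u} R) :
    ExtMod R i (ModuleCat.of R (R ⧸ a ^ n)) Y ⟶ LC R a i Y :=
  (colimit.ι (localCohomology.diagram (localCohomology.idealPowersDiagram a) i)
    (op (op n))).app Y

/-- colimit cocone -/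
def lcIsColimit (a : Ideal R) (i : ℕ) (Y : ModuleCat.{u} R) :
    IsColimit (((evaluation (ModuleCat.{u} R) (ModuleCat.{u} R)).obj Y).mapCocone
      (colimit.cocone (localCohomology.diagram (localCohomology.idealPowersDiagram a) i))) :=
  isColimitOfPreserves _ (colimit.isColimit _)

instance presFilt : PreservesFilteredColimitsOfSize.{0, 0} (forget (ModuleCat.{u} R)) :=
  preservesSmallestFilteredColimits_of_preservesFilteredColimits.{u, u} _

lemma lc_rep (a : Ideal R) (i : ℕ) (Y : ModuleCat.{u} R) (z : LC R a i Y) :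
    ∃ n x, lcι a i n Y x = z := by
  obtain ⟨j, y, hy⟩ := Concrete.isColimit_exists_rep _ (lcIsColimit a i Y) z
  exact ⟨j.unop.unop, y, hy⟩

lemma lc_zero (a : Ideal R) (i : ℕ) (Y : ModuleCat.{u} R) (n) (x) (h : lcι a i n Y x = 0) :
    ∃ m, ∃ h : n ≤ m, ConcreteCategory.hom (((Ext R (ModuleCat.{u} R) i).map
      (qm (Ideal.pow_le_pow_right (I := a) h)).op).app Y) x = 0 := by
  obtain ⟨k, f, g, hfg⟩ := Concrete.isColimit_exists_of_rep_eq _ (lcIsColimit a i Y)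
    (i := op (op n)) (j := op (op n)) x 0 (h.trans (map_zero (lcι a i n Y).hom).symm)
  refine ⟨k.unop.unop, f.unop.unop.down.down, hfg.trans ?_⟩
  exact map_zero _

lemma lc_nat (a : Ideal R) (i : ℕ) (Y : ModuleCat.{u} R) (n m) (h : n ≤ m) (x) :
    lcι a i m Y (ConcreteCategory.hom (((Ext R (ModuleCat.{u} R) i).map
      (qm (Ideal.pow_le_pow_right (I := a) h)).op).app Y) x) = lcι a i n Y x := by
  have := colimit.w (localCohomology.diagram (localCohomology.idealPowersDiagram a) i)
    (show op (op n) ⟶ op (op m) from (homOfLE h).op.op)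
  exact congr($(this).app Y x)

/-- class of an extension -/
def cls (a : Ideal R) (i n : ℕ) (Y : ModuleCat.{u} R) :
    Abelian.Ext.{u} (ModuleCat.of R (R ⧸ a ^ n)) Y (i+1) →ₗ[R] LC R a (i+1) Y :=
  (lcι a (i+1) n Y).hom ∘ₗ glin _ _ i

abbrev pw (a : Ideal R) {n m : ℕ} (h : n ≤ m) : a ^ m ≤ a ^ n := Ideal.pow_le_pow_right h

lemma cls_res (a : Ideal R) (i : ℕ) (Y : ModuleCat.{u} R) {n m : ℕ} (h : n ≤ m) (ξ) :
    cls a i m Y (res (pw a h) ξ) = cls a i n Y ξ := by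
  refine (congrArg (lcι a (i+1) m Y).hom (glin_nat _ _ _ _)).trans ?_
  exact lc_nat a (i+1) Y n m h _

lemma cls_surj (a : Ideal R) (i : ℕ) (Y : ModuleCat.{u} R) (z : LC R a (i+1) Y) :
    ∃ n ξ, cls a i n Y ξ = z := by
  obtain ⟨n, x, rfl⟩ := lc_rep a _ Y z
  obtain ⟨ξ, rfl⟩ := glin_surjective _ _ _ x
  exact ⟨n, ξ, rfl⟩

lemma cls_zero (a : Ideal R) (i : ℕ) (Y : ModuleCat.{u} R) {n : ℕ} (ξ)
    (h : cls a i n Y ξ = 0) : ∃ m, ∃ h : n ≤ m, res (pw a h) ξ = 0 := by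
  obtain ⟨m, h, hm⟩ := lc_zero a (i+1) Y n _ h
  refine ⟨m, h, glin_injective _ _ _ _ ?_⟩
  exact (glin_nat _ _ _ _).trans hm

end lcint
section vanishing
open CategoryTheory CategoryTheory.Abelian

variable {R : Type u} [CommRing R]

/-- ind-vanishing -/
def Van (a : Ideal R) (i : ℕ) (Y : ModuleCat.{u} R) : Prop :=
  ∀ (n : ℕ) (ξ : Abelian.Ext.{u} (ModuleCat.of R (R ⧸ a ^ n)) Y i),
    ∃ m, ∃ h : n ≤ m, res (pw a h) ξ = 0

variable {a : Ideal R} {i : ℕ} {S : ShortComplex (ModuleCat.{u} R)}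

lemma Van.lift (hS : S.ShortExact) (h3 : Van a i S.X₃) (n : ℕ)
    (ξ : Abelian.Ext.{u} (ModuleCat.of R (R ⧸ a ^ n)) S.X₂ i) :
    ∃ m, ∃ h : n ≤ m, ∃ ζ : Abelian.Ext.{u} (ModuleCat.of R (R ⧸ a ^ m)) S.X₁ i,
      ζ.comp (Abelian.Ext.mk₀ S.f) (add_zero i) = res (pw a h) ξ := by
  obtain ⟨m, h, hm⟩ := h3 n (ξ.comp (Abelian.Ext.mk₀ S.g) (add_zero i))
  rw [res_comp] at hm
  exact ⟨m, h, Abelian.Ext.covariant_sequence_exact₂ _ hS _ hm⟩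

lemma Van.mid (hS : S.ShortExact) (h1 : Van a i S.X₁) (h3 : Van a i S.X₃) : Van a i S.X₂ := by
  intro n ξ
  obtain ⟨m, h, ζ, hζ⟩ := Van.lift hS h3 n ξ
  obtain ⟨l, h', hl⟩ := h1 m ζ
  refine ⟨l, h.trans h', ?_⟩
  rw [← res_res (pw a h') (pw a h), ← hζ, res_comp, hl, Abelian.Ext.zero_comp]

lemma Van.right (hS : S.ShortExact) (h2 : Van a i S.X₂) (h1 : Van a (i+1) S.X₁) : Van a i S.X₃ := by
  intro n ξ
  obtain ⟨m, h, hm⟩ := h1 n (ξ.comp hS.extClass rfl)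
  rw [res_comp] at hm
  obtain ⟨ζ, hζ⟩ := Abelian.Ext.covariant_sequence_exact₃ _ hS _ _ hm
  obtain ⟨l, h', hl⟩ := h2 m ζ
  refine ⟨l, h.trans h', ?_⟩
  rw [← res_res (pw a h') (pw a h), ← hζ, res_comp, hl, Abelian.Ext.zero_comp]

lemma Van.inj (hS : S.ShortExact) (h3 : Van a i S.X₃) (n : ℕ)
    (ξ : Abelian.Ext.{u} (ModuleCat.of R (R ⧸ a ^ n)) S.X₁ (i+1))
    (hξ : ξ.comp (Abelian.Ext.mk₀ S.f) (add_zero _) = 0) :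
    ∃ m, ∃ h : n ≤ m, res (pw a h) ξ = 0 := by
  obtain ⟨ζ, rfl⟩ := Abelian.Ext.covariant_sequence_exact₁ _ hS _ hξ rfl
  obtain ⟨l, h', hl⟩ := h3 n ζ
  refine ⟨l, h', ?_⟩
  rw [res_comp, hl, Abelian.Ext.zero_comp]

lemma Van.of_iso {Y Z : ModuleCat.{u} R} (e : Y ≅ Z) (h : Van a i Y) : Van a i Z := by
  intro n ξ
  obtain ⟨m, h', hm⟩ := h n (ξ.comp (Abelian.Ext.mk₀ e.inv) (add_zero _))
  refine ⟨m, h', ?_⟩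
  rw [res_comp] at hm
  have := congrArg (fun z => z.comp (Abelian.Ext.mk₀ e.hom) (add_zero _)) hm
  simpa using this

/-- ideal sequence -/
abbrev idS (A : Ideal R) : ShortComplex (ModuleCat.{u} R) where
  X₁ := ModuleCat.of R A
  X₂ := ModuleCat.of R R
  X₃ := ModuleCat.of R (R ⧸ A)
  f := ModuleCat.ofHom A.subtype
  g := ModuleCat.ofHom (Submodule.mkQ A)
  zero := by
    ext x
    exact (Submodule.Quotient.mk_eq_zero A).2 x.2

lemma idS_exact (A : Ideal R) : (idS A).ShortExact where
  exact := (ShortComplex.ShortExact.moduleCat_exact_iff_function_exact _).mpr fun x => by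
    exact (Submodule.Quotient.mk_eq_zero A).trans (by simp)
  mono_f := (ModuleCat.mono_iff_injective _).mpr A.injective_subtype
  epi_g := (ModuleCat.epi_iff_surjective _).mpr (Submodule.mkQ_surjective A)

/-- inclusion -/
def inc {A B : Ideal R} (h : A ≤ B) : ModuleCat.of R A ⟶ ModuleCat.of R B :=
  ModuleCat.ofHom (Submodule.inclusion h)

/-- morphism -/
def idSmap {A B : Ideal R} (h : A ≤ B) : idS A ⟶ idS B where
  τ₁ := inc h
  τ₂ := 𝟙 _
  τ₃ := qm h

lemma res_extClass {A B : Ideal R} (h : A ≤ B) {Y : ModuleCat.{u} R} {i l : ℕ} (hl : 1 + i = l)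
    (ζ : Abelian.Ext.{u} (ModuleCat.of R B) Y i) :
    res h ((idS_exact B).extClass.comp ζ hl) =
      (idS_exact A).extClass.comp ((Abelian.Ext.mk₀ (inc h)).comp ζ (zero_add i)) hl := by
  have := ShortComplex.ShortExact.extClass_naturality (idS_exact A) (idS_exact B) (idSmap h)
  rw [res_comp, ← Abelian.Ext.comp_assoc (γ := ζ) _ _ (add_zero 1) (zero_add i) (by lia)]
  exact congrArg (fun z => Abelian.Ext.comp z ζ hl) this.symm

lemma proj_of (F : Type u) [AddCommGroup F] [Module R F] [Module.Free R F] :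
    Projective (ModuleCat.of R F) := 
  (IsProjective.iff_projective F).1 inferInstance

lemma ext_surj_extClass (B : Ideal R) (Y : ModuleCat.{u} R) (i : ℕ)
    (ξ : Abelian.Ext.{u} (ModuleCat.of R (R ⧸ B)) Y (i+1)) :
    ∃ ζ : Abelian.Ext.{u} (ModuleCat.of R B) Y i, (idS_exact B).extClass.comp ζ (by lia) = ξ := by
  have := proj_of (R := R) R
  exact Abelian.Ext.contravariant_sequence_exact₃ (idS_exact B) Y ξ
    (Abelian.Ext.eq_zero_of_projective (P := ModuleCat.of R R) _) (by lia)

variable [IsNoetherianRing R]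

lemma artin_van (a : Ideal R) (M : ModuleCat.{u} R) (t : ℕ) (hM : ∀ r ∈ a ^ t, ∀ x : M, r • x = 0)
    (i : ℕ) : ∀ (X : Type u) [AddCommGroup X] [Module R X] [Module.Finite R X]
    (ξ : Abelian.Ext.{u} (ModuleCat.of R X) M i),
    ∃ m, ∀ (L : Type u) [AddCommGroup L] [Module R L] (g : L →ₗ[R] X),
      (∀ x, g x ∈ (a ^ m • ⊤ : Submodule R X)) →
        (Abelian.Ext.mk₀ (ModuleCat.ofHom g)).comp ξ (zero_add i) = 0 := by
  induction i with
  | zero =>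
    intro X _ _ _ ξ
    obtain ⟨f, rfl⟩ := (Abelian.Ext.mk₀_bijective _ _).2 ξ
    refine ⟨t, fun L _ _ g hg => ?_⟩
    rw [Abelian.Ext.mk₀_comp_mk₀]
    refine (congrArg Abelian.Ext.mk₀ ?_).trans (Abelian.Ext.mk₀_zero _ _)
    ext x
    have h : ∀ y ∈ (a ^ t • ⊤ : Submodule R X), f.hom y = 0 := by
      intro y hy
      induction hy using Submodule.smul_induction_on' with
      | smul r hr n hn => rw [map_smul]; exact hM r hr _
      | add x hx y hy h1 h2 => rw [map_add, h1, h2, add_zero]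
    exact h _ (hg x)
  | succ i ih =>
    intro X _ _ _ ξ
    obtain ⟨r, f, hf⟩ := Module.Finite.exists_fin' R X
    have hS := LinearMap.shortExact_shortComplexKer hf
    have : Projective f.shortComplexKer.X₂ := proj_of (R := R) _
    obtain ⟨ζ, hζ⟩ := Abelian.Ext.contravariant_sequence_exact₃ hS M ξ
      (Abelian.Ext.eq_zero_of_projective _) (n₀ := i) (by lia)
    obtain ⟨c₀, hc₀⟩ := ih (LinearMap.ker f) ζ
    obtain ⟨c, hc⟩ := Ideal.exists_pow_inf_eq_pow_smul a (LinearMap.ker f)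
    refine ⟨c + c₀, fun L _ _ g hg => ?_⟩
    let m := c + c₀
    let f' : (a ^ m • ⊤ : Submodule R (Fin r → R)) →ₗ[R] (a ^ m • ⊤ : Submodule R X) :=
      f.restrict (fun x hx => by
        have : f x ∈ (a ^ m • ⊤ : Submodule R (Fin r → R)).map f := ⟨x, hx, rfl⟩
        rw [Submodule.map_smul''] at this
        exact Submodule.smul_mono le_rfl le_top this)
    have hf' : Function.Surjective f' := by
      rintro ⟨y, hy⟩
      have h1 : (a ^ m • ⊤ : Submodule R (Fin r → R)).map f = (a ^ m • ⊤ : Submodule R X) := by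
        rw [Submodule.map_smul'', Submodule.map_top, LinearMap.range_eq_top.2 hf]
      rw [← h1] at hy
      obtain ⟨x, hx, rfl⟩ := hy
      exact ⟨⟨x, hx⟩, rfl⟩
    have hS' := LinearMap.shortExact_shortComplexKer hf'
    let κ : LinearMap.ker f' →ₗ[R] LinearMap.ker f :=
      LinearMap.codRestrict _ ((Submodule.subtype _) ∘ₗ (Submodule.subtype _))
        (fun x => congrArg Subtype.val x.2)
    let φ : f'.shortComplexKer ⟶ f.shortComplexKer :=
      { τ₁ := ModuleCat.ofHom κ
        τ₂ := ModuleCat.ofHom (Submodule.subtype _)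
        τ₃ := ModuleCat.ofHom (Submodule.subtype _) }
    have hκ : ∀ x, κ x ∈ (a ^ c₀ • ⊤ : Submodule R (LinearMap.ker f)) := by
      intro x
      have h1 : (κ x : Fin r → R) ∈ (a ^ m • ⊤ ⊓ LinearMap.ker f : Submodule R (Fin r → R)) :=
        ⟨x.1.2, (κ x).2⟩
      rw [hc m (by lia)] at h1
      have h2 : (κ x : Fin r → R) ∈ (a ^ c₀ • LinearMap.ker f : Submodule R (Fin r → R)) := by
        have : m - c = c₀ := by lia
        rw [this] at h1
        exact Submodule.smul_mono le_rfl inf_le_right h1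
      have h3 : (a ^ c₀ • ⊤ : Submodule R (LinearMap.ker f)).map (Submodule.subtype _) =
          a ^ c₀ • LinearMap.ker f := by
        rw [Submodule.map_smul'', Submodule.map_top, Submodule.range_subtype]
      rw [← h3] at h2
      obtain ⟨y, hy, hyx⟩ := h2
      rwa [← Subtype.ext (a1 := y) (a2 := κ x) hyx]
    have key := ShortComplex.ShortExact.extClass_naturality hS' hS φ
    have h1 : (Abelian.Ext.mk₀ φ.τ₃).comp ξ (zero_add _) = 0 := by
      rw [← hζ, ← Abelian.Ext.comp_assoc (γ := ζ) _ _ (zero_add 1) _ (by lia), ← key,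
        Abelian.Ext.comp_assoc (γ := ζ) _ _ _ (zero_add i) (by lia)]
      have := hc₀ (LinearMap.ker f') κ hκ
      exact (congrArg (fun z => Abelian.Ext.comp hS'.extClass z _) this).trans
        (Abelian.Ext.comp_zero _ _ _ _ _)
    have h2 : ModuleCat.ofHom g = ModuleCat.ofHom (LinearMap.codRestrict _ g hg) ≫ φ.τ₃ := rfl
    rw [h2, ← Abelian.Ext.mk₀_comp_mk₀_assoc, h1, Abelian.Ext.comp_zero]

lemma van_torsion (a : Ideal R) (M : ModuleCat.{u} R) (t : ℕ)
    (hM : ∀ r ∈ a ^ t, ∀ x : M, r • x = 0) (i : ℕ) : Van a (i+1) M := by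
  intro n ξ
  obtain ⟨ζ, rfl⟩ := ext_surj_extClass _ _ _ ξ
  obtain ⟨m, hm⟩ := artin_van a M t hM i _ ζ
  refine ⟨m + n, by lia, ?_⟩
  have : (Abelian.Ext.mk₀ (inc (pw a (show n ≤ m + n by lia)))).comp ζ (zero_add i) = 0 := by
    refine hm _ _ fun x => ?_
    have h2 : (a ^ m • ⊤ : Submodule R (a ^ n : Ideal R)).map (Submodule.subtype _) =
        a ^ (m + n) := by
      rw [Submodule.map_smul'', Submodule.map_top, Submodule.range_subtype, pow_add]; rfl
    have hx := x.2
    replace hx := h2.ge hx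
    obtain ⟨y, hy, hyx⟩ := hx
    have h3 : y = Submodule.inclusion (pw a (show n ≤ m + n by lia)) x := Subtype.ext hyx
    exact h3 ▸ hy
  rw [res_extClass, this, Abelian.Ext.comp_zero]

end vanishing
section vanishing2
open CategoryTheory CategoryTheory.Abelian

variable {R : Type u} [CommRing R] [IsNoetherianRing R]

lemma van_subsingleton (J : Ideal R) (i : ℕ) (N : ModuleCat.{u} R) [Subsingleton N] :
    Van J i N := by
  intro n ξ
  refine ⟨n, le_rfl, ?_⟩
  have h : ξ = 0 := by
    have h1 : 𝟙 N = 0 := by ext x; exact Subsingleton.elim _ _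
    rw [← Abelian.Ext.comp_mk₀_id ξ, h1, Abelian.Ext.mk₀_zero, Abelian.Ext.comp_zero]
  rw [h, res_zero]

lemma van_fg (J : Ideal R) (i : ℕ) (M : Type u) [AddCommGroup M] [Module R M]
    (hfin : Module.Finite R M)
    (h : ∀ p : PrimeSpectrum R, Module.annihilator R M ≤ p.asIdeal →
      Van J i (ModuleCat.of R (R ⧸ p.asIdeal))) : Van J i (ModuleCat.of R M) := by
  induction hfin using IsNoetherianRing.induction_on_isQuotientEquivQuotientPrime R with
  | subsingleton N => exact van_subsingleton _ _ _
  | quotient N p f =>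
    refine Van.of_iso f.symm.toModuleIso (h p ?_)
    rw [f.annihilator_eq, Ideal.annihilator_quotient]
  | exact N₁ N₂ N₃ f g hf hg hfg h₁ h₃ =>
    have hS : (ModuleCat.shortComplexOfCompEqZero f g hfg.linearMap_comp_eq_zero).ShortExact :=
      ModuleCat.shortComplex_shortExact _ hfg hf hg
    exact Van.mid hS (h₁ fun p hp => h p ((f.annihilator_le_of_injective hf).trans hp))
      (h₃ fun p hp => h p ((g.annihilator_le_of_surjective hg).trans hp))

lemma smul_pow_eq_zero (J : Ideal R) (n i : ℕ) (Y : ModuleCat.{u} R)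
    (ξ : Abelian.Ext.{u} (ModuleCat.of R (R ⧸ J ^ n)) Y i) (y : R) (hy : y ∈ J ^ n) :
    y • ξ = 0 := by
  have h1 : y • 𝟙 (ModuleCat.of R (R ⧸ J ^ n)) = 0 := by
    ext
    change y • (Submodule.Quotient.mk 1 : R ⧸ J ^ n) = 0
    rw [← Submodule.Quotient.mk_smul, Submodule.Quotient.mk_eq_zero]
    simpa using hy
  rw [← Abelian.Ext.mk₀_id_comp ξ, ← Abelian.Ext.smul_comp, ← Abelian.Ext.mk₀_smul, h1,
    Abelian.Ext.mk₀_zero, Abelian.Ext.zero_comp]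

lemma van_dim (J : Ideal R) (n : ℕ) : ∀ (i : ℕ) (_ : n ≤ i) (M : Type u) [AddCommGroup M]
    [Module R M] [Module.Finite R M]
    (_ : ∀ q : PrimeSpectrum R, Module.annihilator R M ≤ q.asIdeal → Order.coheight q < n),
    Van J (i+1) (ModuleCat.of R M) := by
  induction n with
  | zero =>
    intro i _ M _ _ hfin h
    exact van_fg J _ M hfin fun p hp => absurd (h p hp) (by simp)
  | succ n ih =>
    intro i hi M _ _ hfin h
    refine van_fg J _ M hfin fun p hp => ?_
    have hpn := h p hp
    by_cases hJ : J ≤ p.asIdeal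
    · refine van_torsion J _ 1 ?_ i
      intro r hr x
      obtain ⟨x, rfl⟩ := Submodule.Quotient.mk_surjective _ x
      rw [← Submodule.Quotient.mk_smul, Submodule.Quotient.mk_eq_zero]
      exact Ideal.mul_mem_right _ _ (hJ (by simpa using hr))
    · obtain ⟨x, hxJ, hxp⟩ := Set.not_subset.1 hJ
      obtain ⟨i, rfl⟩ : ∃ j, i = j + 1 := ⟨i - 1, by lia⟩
      let f : (R ⧸ p.asIdeal) →ₗ[R] (R ⧸ p.asIdeal) := LinearMap.lsmul R _ x
      let Q := (R ⧸ p.asIdeal) ⧸ LinearMap.range f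
      have hf : Function.Injective f := by
        rw [injective_iff_map_eq_zero]
        intro y hy
        obtain ⟨y, rfl⟩ := Submodule.Quotient.mk_surjective _ y
        change x • (Submodule.Quotient.mk y : R ⧸ p.asIdeal) = 0 at hy
        rw [← Submodule.Quotient.mk_smul, Submodule.Quotient.mk_eq_zero] at hy
        rw [Submodule.Quotient.mk_eq_zero]
        exact (p.2.mem_or_mem hy).resolve_left hxp
      have hfg : Function.Exact f (LinearMap.range f).mkQ := LinearMap.exact_map_mkQ_range f
      have hS : (ModuleCat.shortComplexOfCompEqZero f _ hfg.linearMap_comp_eq_zero).ShortExact :=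
        ModuleCat.shortComplex_shortExact _ hfg hf (Submodule.mkQ_surjective _)
      have hQ : Van J (i+1) (ModuleCat.of R Q) := by
        refine ih i (by lia) Q fun q hq => ?_
        have h1 : p.asIdeal ≤ q.asIdeal := by
          refine le_trans ?_ hq
          refine le_trans ?_ (((LinearMap.range f).mkQ).annihilator_le_of_surjective
            (Submodule.mkQ_surjective _))
          rw [Ideal.annihilator_quotient]
        have h2 : x ∈ q.asIdeal := by
          refine hq ?_
          rw [Module.mem_annihilator]
          intro y
          obtain ⟨y, rfl⟩ := Submodule.Quotient.mk_surjective _ y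
          rw [← Submodule.Quotient.mk_smul, Submodule.Quotient.mk_eq_zero]
          exact ⟨y, rfl⟩
        have h3 : p < q := lt_of_le_of_ne h1 (by rintro rfl; exact hxp h2)
        have h4 := Order.coheight_add_one_le h3
        have h5 := h4.trans_lt hpn
        push_cast at h5
        exact lt_of_add_lt_add_right h5
      have key : ∀ s n, ∀ ξ : Abelian.Ext.{u} (ModuleCat.of R (R ⧸ J ^ n))
          (ModuleCat.of R (R ⧸ p.asIdeal)) (i+1+1), x ^ s • ξ = 0 →
          ∃ m, ∃ h : n ≤ m, res (pw J h) ξ = 0 := by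
        intro s
        induction s with
        | zero => intro n ξ h; exact ⟨n, le_rfl, by rw [pow_zero, one_smul] at h; rw [h, res_zero]⟩
        | succ s ihs =>
          intro n ξ h
          have h1 := Van.inj hS hQ n (x ^ s • ξ) (by
            have : ModuleCat.ofHom f = x • 𝟙 _ := rfl
            refine (congrArg (fun z => Abelian.Ext.comp _ (Abelian.Ext.mk₀ z) _) this).trans ?_
            rw [Abelian.Ext.mk₀_smul]
            refine (Abelian.Ext.comp_smul _ _ _ _).trans ?_
            refine (congrArg (fun z => x • z) (Abelian.Ext.comp_mk₀_id _)).trans ?_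
            rw [smul_smul, ← pow_succ', h])
          obtain ⟨m, hm, h2⟩ := h1
          have h2' := (res_smul _ _ _).symm.trans h2
          obtain ⟨l, hl, h3⟩ := ihs m _ h2'
          exact ⟨l, hm.trans hl, by rw [← h3, res_res]⟩
      intro n ξ
      exact key n n ξ (smul_pow_eq_zero J n _ _ ξ _ (Ideal.pow_mem_pow hxJ n))

variable [IsLocalRing R]

lemma van_large (J : Ideal R) : ∃ d : ℕ, ∀ i, d ≤ i → ∀ (M : Type u) [AddCommGroup M]
    [Module R M] [Module.Finite R M], Van J (i+1) (ModuleCat.of R M) := by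
  have : FiniteDimensionalOrder (PrimeSpectrum R) := inferInstanceAs (FiniteRingKrullDim R)
  let s := LTSeries.longestOf (PrimeSpectrum R)
  refine ⟨s.length + 1, fun i hi M _ _ _ => van_dim J (s.length + 1) i hi M fun q _ => ?_⟩
  have : Order.coheight q ≤ s.length := Order.coheight_le fun p _ => by
    exact_mod_cast LTSeries.longestOf_is_longest p
  exact this.trans_lt (by norm_cast; lia)

lemma van_all (J : Ideal R) (h : ∀ i, 2 ≤ i → Van J i (ModuleCat.of R R)) (i : ℕ) (hi : 2 ≤ i)
    (M : Type u) [AddCommGroup M] [Module R M] [Module.Finite R M] :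
    Van J i (ModuleCat.of R M) := by
  obtain ⟨d, hd⟩ := van_large J
  have key : ∀ e i, 2 ≤ i → d + 1 ≤ i + e → ∀ (M : Type u) [AddCommGroup M] [Module R M]
      [Module.Finite R M], Van J i (ModuleCat.of R M) := by
    intro e
    induction e with
    | zero =>
      intro i hi hie M _ _ _
      obtain ⟨j, rfl⟩ : ∃ j, i = j + 1 := ⟨i - 1, by lia⟩
      exact hd j (by lia) M
    | succ e ih =>
      intro i hi hie M _ _ hfin
      refine van_fg J i M hfin fun p _ => ?_
      exact Van.right (idS_exact p.asIdeal) (h i hi) (ih (i+1) (by lia) (by lia) p.asIdeal)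
  exact key (d+1) i hi (by lia) M

lemma exists_lift (J : Ideal R) (h : ∀ i, 2 ≤ i → Van J i (ModuleCat.of R R)) :
    ∃ (m r : ℕ) (x : Fin r → R) (φ : Fin r → ((J ^ m : Ideal R) →ₗ[R] R)),
      (∀ i, x i ∈ J) ∧ ∀ y : (J ^ m : Ideal R), ∑ i, x i * φ i y = y := by
  obtain ⟨r, f, hf⟩ := Module.Finite.exists_fin' R (J ^ 1 : Ideal R)
  have hS := LinearMap.shortExact_shortComplexKer hf
  have hV : Van J 2 (f.shortComplexKer).X₁ := van_all J h 2 le_rfl (LinearMap.ker f)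
  obtain ⟨m, hm, h0⟩ := hV 1 ((idS_exact (J ^ 1)).extClass.comp hS.extClass rfl)
  rw [res_extClass (pw J hm) _ _] at h0
  obtain ⟨x₂, hx₂⟩ := Abelian.Ext.contravariant_sequence_exact₁ (idS_exact (J ^ m)) _ _ _ h0
  have := proj_of (R := R) R
  rw [Abelian.Ext.eq_zero_of_projective (P := ModuleCat.of R R) x₂, Abelian.Ext.comp_zero] at hx₂
  obtain ⟨ψ, hψ⟩ := Abelian.Ext.covariant_sequence_exact₃ _ hS _ _ hx₂.symm
  obtain ⟨ψ, rfl⟩ := (Abelian.Ext.mk₀_bijective _ _).2 ψ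
  rw [Abelian.Ext.mk₀_comp_mk₀] at hψ
  have hψ' := (Abelian.Ext.mk₀_bijective _ _).1 hψ
  let ψ' : (J ^ m : Ideal R) →ₗ[R] (Fin r → R) := ψ.hom
  have hψ2 : ∀ y, f (ψ' y) = Submodule.inclusion (pw J hm) y := fun y => congr($hψ' y)
  refine ⟨m, r, fun i => f (Pi.single i 1), fun i => LinearMap.proj i ∘ₗ ψ', fun i => ?_, fun y => ?_⟩
  · simpa using (f (Pi.single i 1)).2
  · have h1 := congrArg Subtype.val (hψ2 y)
    have h2 : ψ' y = ∑ i, ψ' y i • Pi.single i 1 := by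
      ext j
      simp [Finset.sum_apply, Pi.single_apply]
    rw [h2] at h1
    simp only [map_sum, map_smul] at h1
    simpa [mul_comm] using h1

end vanishing2
section final
open CategoryTheory CategoryTheory.Abelian CategoryTheory.Limits

variable {R : Type u} [CommRing R]

lemma pres_yon (Y : ModuleCat.{u} R) :
    PreservesFiniteLimits ((linearYoneda R (ModuleCat.{u} R)).obj Y) := by
  have h : PreservesLimitsOfSize.{0, 0} ((linearYoneda R (ModuleCat.{u} R)).obj Y ⋙
      forget (ModuleCat.{u} R)) :=
    inferInstanceAs (PreservesLimitsOfSize.{0, 0} (yoneda.obj Y))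
  have := preservesLimits_of_reflects_of_preserves.{0, 0}
    ((linearYoneda R (ModuleCat.{u} R)).obj Y) (forget (ModuleCat.{u} R))
  exact PreservesLimitsOfSize.preservesFiniteLimits _

lemma ext_zero (X Y : ModuleCat.{u} R) : Nonempty (ExtMod R 0 X Y ≃ₗ[R] (X ⟶ Y)) := by
  have := pres_yon Y
  have := preservesFiniteColimits_rightOp ((linearYoneda R (ModuleCat.{u} R)).obj Y)
  have e := ((((linearYoneda R (ModuleCat.{u} R)).obj Y).rightOp.leftDerivedZeroIsoSelf).app X).unop
  exact ⟨(show ModuleCat.of R (X ⟶ Y) ≅ ExtMod R 0 X Y from e).toLinearEquiv.symm⟩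

/-- annihilated submodule -/
def annSub (a : Ideal R) (M : Type u) [AddCommGroup M] [Module R M] : Submodule R M :=
  Submodule.torsionBySet R M (a : Set R)

lemma mem_annSub {a : Ideal R} {M : Type u} [AddCommGroup M] [Module R M] {z : M} :
    z ∈ annSub a M ↔ ∀ r ∈ a, r • z = 0 := by
  simp [annSub]

lemma annSub_fg [IsNoetherianRing R] (a : Ideal R) (M : ModuleCat.{u} R)
    (h : Module.Finite R (ExtMod R 0 (ModuleCat.of R (R ⧸ a)) M)) : (annSub a M).FG := by
  obtain ⟨e⟩ := ext_zero (ModuleCat.of R (R ⧸ a)) M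
  have := Module.Finite.equiv e
  let ev : (ModuleCat.of R (R ⧸ a) ⟶ M) →ₗ[R] M :=
    { toFun := fun f => f.hom (Submodule.Quotient.mk 1)
      map_add' := fun f g => rfl
      map_smul' := fun r f => rfl }
  have h1 : annSub a M ≤ LinearMap.range ev := by
    intro z hz
    rw [mem_annSub] at hz
    refine ⟨ModuleCat.ofHom (Submodule.liftQ a (LinearMap.toSpanSingleton R M z) ?_), ?_⟩
    · intro r hr
      exact hz r hr
    · exact one_smul R z
  have h2 : IsNoetherian R (LinearMap.range ev) := isNoetherian_of_isNoetherianRing_of_finite R _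
  have h3 := (isNoetherian_submodule.1 h2) _ h1
  exact h3

lemma killed (I J : Ideal R) (i : ℕ)
    (h : Subsingleton (LC R (I ⊓ J) (i+1) (ModuleCat.of R R)))
    (z : LC R I (i+1) (ModuleCat.of R R)) : ∃ m, ∀ r ∈ J ^ m, r • z = 0 := by
  obtain ⟨n, ξ, rfl⟩ := cls_surj I i _ z
  have hle : ∀ m, (I ⊓ J) ^ m ≤ I ^ m := fun m => Ideal.pow_right_mono inf_le_left m
  obtain ⟨m, hm, h0⟩ := cls_zero (I ⊓ J) i _ (res (hle n) ξ) (Subsingleton.elim _ _)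
  have h1 : res (hle m) (res (pw I hm) ξ) = 0 := by
    rw [res_res] at h0 ⊢
    exact h0
  refine ⟨m, fun r hr => ?_⟩
  let f : (R ⧸ (I ⊓ J) ^ m) →ₗ[R] (R ⧸ I ^ m) := Submodule.mapQ _ _ LinearMap.id (hle m)
  have hf : Function.Surjective f := by
    intro y
    obtain ⟨y, rfl⟩ := Submodule.Quotient.mk_surjective _ y
    exact ⟨Submodule.Quotient.mk y, rfl⟩
  have hS := LinearMap.shortExact_shortComplexKer hf
  obtain ⟨ζ, hζ⟩ := Abelian.Ext.contravariant_sequence_exact₃ hS (ModuleCat.of R R)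
    (res (pw I hm) ξ) h1 (n₀ := i) (by lia)
  have h2 : r • 𝟙 (ModuleCat.of R (LinearMap.ker f)) = 0 := by
    ext y
    obtain ⟨y, hy⟩ := y
    obtain ⟨b, rfl⟩ := Submodule.Quotient.mk_surjective _ y
    have hb : b ∈ I ^ m := (Submodule.Quotient.mk_eq_zero _).1 hy
    change r • (Submodule.Quotient.mk b : R ⧸ (I ⊓ J) ^ m) = 0
    rw [← Submodule.Quotient.mk_smul, Submodule.Quotient.mk_eq_zero]
    have h3 : (J * I) ^ m ≤ (I ⊓ J) ^ m :=
      Ideal.pow_right_mono (le_inf Ideal.mul_le_right Ideal.mul_le_left) m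
    apply h3
    rw [mul_pow]
    exact Ideal.mul_mem_mul hr hb
  have h4 : r • ζ = 0 := by
    have h5 : ζ = (Abelian.Ext.mk₀ (𝟙 _)).comp ζ (zero_add i) := (Abelian.Ext.mk₀_id_comp ζ).symm
    rw [h5, ← Abelian.Ext.smul_comp, ← Abelian.Ext.mk₀_smul]
    refine (congrArg (fun z => (Abelian.Ext.mk₀ z).comp ζ (zero_add i)) h2).trans ?_
    rw [Abelian.Ext.mk₀_zero, Abelian.Ext.zero_comp]
  rw [← cls_res I i _ hm, ← map_smul, ← hζ]
  have h6 : r • hS.extClass.comp ζ (show 1 + i = i + 1 by lia) = 0 := by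
    rw [← Abelian.Ext.comp_smul, h4, Abelian.Ext.comp_zero]
  exact (congrArg _ h6).trans (map_zero _)

lemma nonvan (I J : Ideal R) (i : ℕ)
    (hsupp : ¬ Module.support R (LC R I (i+1) (ModuleCat.of R R)) ⊆
        PrimeSpectrum.zeroLocus (J : Set R)) :
    ¬ Subsingleton (LC R (I ⊓ J) (i+1) (ModuleCat.of R R)) := by
  intro h
  apply hsupp
  intro p hp
  rw [Module.mem_support_iff'] at hp
  obtain ⟨z, hz⟩ := hp
  obtain ⟨m, hm⟩ := killed I J i h z
  have h1 : J ^ m ≤ p.asIdeal := fun r hr => by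
    by_contra hrp
    exact hz r hrp (hm r hr)
  exact p.2.le_of_pow_le h1

lemma ann_le [IsNoetherianRing R] [IsLocalRing R] (a J : Ideal R) (haJ : a ≤ J) (j : ℕ)
    (h : ∀ i, 2 ≤ i → Van J i (ModuleCat.of R R)) :
    annSub a (LC R a (j+2) (ModuleCat.of R R)) ≤
      J • annSub a (LC R a (j+2) (ModuleCat.of R R)) := by
  obtain ⟨m, r, x, φ, hx, hφ⟩ := exists_lift J h
  have hV : ∀ i, Van a (i+1) (idS (J ^ m)).X₃ := fun i => by
    refine van_torsion a _ m ?_ i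
    intro s hs y
    obtain ⟨y, rfl⟩ := Submodule.Quotient.mk_surjective _ y
    refine (Submodule.Quotient.mk_smul _ s y).symm.trans ((Submodule.Quotient.mk_eq_zero _).2 ?_)
    exact Ideal.mul_mem_right _ _ (Ideal.pow_right_mono haJ m hs)
  intro z hz
  rw [mem_annSub] at hz
  obtain ⟨n, ξ, rfl⟩ := cls_surj a (j+1) _ z
  obtain ⟨l, hl, ζ, hζ⟩ := Van.lift (idS_exact (J ^ m)) (hV (j+1)) n ξ
  let c : Fin r → LC R a (j+2) (ModuleCat.of R R) := fun t =>
    cls a (j+1) l _ (ζ.comp (Abelian.Ext.mk₀ (ModuleCat.ofHom (φ t))) (add_zero _))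
  have hc : ∀ t, c t ∈ annSub a (LC R a (j+2) (ModuleCat.of R R)) := by
    intro t
    rw [mem_annSub]
    intro s hs
    have h1 : cls a (j+1) l (ModuleCat.of R R)
        (s • ζ.comp (Abelian.Ext.mk₀ (idS (J ^ m)).f) (add_zero _)) = 0 := by
      rw [map_smul, hζ, cls_res a (j+1) _ hl]
      exact hz s hs
    obtain ⟨l', hl', h2⟩ := cls_zero _ _ _ _ h1
    have h2' : (res (pw a hl') (s • ζ)).comp (Abelian.Ext.mk₀ (idS (J ^ m)).f) (add_zero _) = 0 := by
      rw [← res_comp, Abelian.Ext.smul_comp]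
      exact h2
    obtain ⟨l'', hl'', h3⟩ := Van.inj (idS_exact (J ^ m)) (hV j) l' _ h2'
    rw [res_res] at h3
    have h4 : s • c t = cls a (j+1) l (ModuleCat.of R R)
        ((s • ζ).comp (Abelian.Ext.mk₀ (ModuleCat.ofHom (φ t))) (add_zero _)) := by
      rw [Abelian.Ext.smul_comp]
      exact (map_smul (cls a (j+1) l (ModuleCat.of R R)) s _).symm
    rw [h4, ← cls_res a (j+1) _ (hl'.trans hl''), res_comp]
    refine (congrArg _ (congrArg (fun z => Abelian.Ext.comp z _ _) h3)).trans ?_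
    rw [Abelian.Ext.zero_comp, map_zero]
  have hsum : ∑ t, x t • c t = cls a (j+1) n (ModuleCat.of R R) ξ := by
    have h5 : (idS (J ^ m)).f = ∑ t, x t • ModuleCat.ofHom (φ t) := by
      apply ModuleCat.hom_ext
      refine LinearMap.ext fun y => ?_
      have := hφ y
      rw [ModuleCat.hom_sum, LinearMap.sum_apply]
      exact this.symm
    rw [← cls_res a (j+1) _ hl, ← hζ, h5]
    have h6 : Abelian.Ext.mk₀.{u} (∑ t, x t • ModuleCat.ofHom (φ t)) =
        ∑ t, x t • Abelian.Ext.mk₀.{u} (ModuleCat.ofHom (φ t)) := by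
      rw [Abelian.Ext.mk₀_sum]
      simp only [Abelian.Ext.mk₀_smul]
    rw [h6, Abelian.Ext.comp_sum, map_sum]
    refine Finset.sum_congr rfl fun t _ => ?_
    rw [Abelian.Ext.comp_smul, map_smul]
  rw [← hsum]
  exact Submodule.sum_mem _ fun t _ => Submodule.smul_mem_smul (hx t) (hc t)

lemma lc_torsion [IsNoetherianRing R] (a : Ideal R) (i : ℕ) (Y : ModuleCat.{u} R)
    (z : LC R a (i+1) Y) : ∃ n, ∀ r ∈ a ^ n, r • z = 0 := by
  obtain ⟨n, ξ, rfl⟩ := cls_surj a i _ z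
  exact ⟨n, fun r hr => by rw [← map_smul, smul_pow_eq_zero a n _ _ ξ r hr, map_zero]⟩

lemma eq_zero_of_ann (a : Ideal R) (M : Type u) [AddCommGroup M] [Module R M]
    (h : annSub a M = ⊥) (n : ℕ) : ∀ z : M, (∀ r ∈ a ^ n, r • z = 0) → z = 0 := by
  induction n with
  | zero => intro z hz; simpa using hz 1 (by simp)
  | succ n ih =>
    intro z hz
    refine ih z fun r hr => ?_
    have : r • z ∈ annSub a M := by
      rw [mem_annSub]
      intro s hs
      rw [smul_smul]
      exact hz _ (by rw [pow_succ']; exact Ideal.mul_mem_mul hs hr)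
    rw [h] at this
    simpa using this

end final

theorem stmt19 (R : Type u) [CommRing R] [IsNoetherianRing R] [IsLocalRing R] (I J : Ideal R)
    (hItop : I ≠ ⊤) (hJtop : J ≠ ⊤)
    (hJcd₁ : ¬ Subsingleton (LC R J 1 (ModuleCat.of R R)))
    (hJcd₂ : ∀ i : ℕ, 2 ≤ i → Subsingleton (LC R J i (ModuleCat.of R R)))
    (k : ℕ) (hk : 2 ≤ k)
    (hsupp : ¬ Module.support R (LC R I k (ModuleCat.of R R)) ⊆
        PrimeSpectrum.zeroLocus (J : Set R)) :
    ¬ IsCofinite R (I ⊓ J) (LC R (I ⊓ J) k (ModuleCat.of R R)) ∧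
      ¬ Subsingleton (LC R (I ⊓ J) k (ModuleCat.of R R)) := by
  obtain ⟨j, rfl⟩ : ∃ j, k = j + 2 := ⟨k - 2, by lia⟩
  have hnv := nonvan I J (j+1) hsupp
  refine ⟨fun hcof => hnv ?_, hnv⟩
  have hV : ∀ i, 2 ≤ i → Van J i (ModuleCat.of R R) := by
    intro i hi n ξ
    obtain ⟨i, rfl⟩ : ∃ l, i = l + 1 := ⟨i - 1, by lia⟩
    have := hJcd₂ _ hi
    exact cls_zero J i _ ξ (Subsingleton.elim _ _)
  have hfg := annSub_fg (I ⊓ J) _ (hcof.2 0)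
  have hbot := Submodule.eq_bot_of_le_smul_of_le_jacobson_bot J _ hfg
    (ann_le (I ⊓ J) J inf_le_right j hV)
    (by rw [IsLocalRing.jacobson_eq_maximalIdeal _ bot_ne_top]
        exact IsLocalRing.le_maximalIdeal hJtop)
  have h0 : ∀ z : LC R (I ⊓ J) (j+2) (ModuleCat.of R R), z = 0 := fun z => by
    obtain ⟨n, hn⟩ := lc_torsion (I ⊓ J) (j+1) _ z
    exact eq_zero_of_ann _ _ hbot n z hn
  exact ⟨fun y z => (h0 y).trans (h0 z).symm⟩
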